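/- arXiv:0910.1122 — 8 statements merged into one kernel-verified Lean document; each statement's English description precedes it below -/
import Mathlib

section
/- Let p : [0,∞) → ℝ be continuous on [0,∞) and differentiable on (0,∞), and suppose there is p₀ > 0 such that t + p′(t) ≥ p₀ for all t > 0 (i.e., min_{t≥0}{t + p′(t)} ≥ p₀, the sparsity condition). Then for every z ∈ ℝ with |z| < p₀, the unique global minimizer of the univariate penalized least squares objective f(θ) = (1/2)(z − θ)² + p(|θ|) over θ ∈ ℝ is θ = 0. (Sparsity property of the penalized least squares estimator.) -/
/-- Sparsity property of the penalized least squares estimator: if `p` is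
continuous on `[0,∞)`, differentiable on `(0,∞)` with derivative `p'`, and
`t + p'(t) ≥ p₀ > 0` for all `t > 0` (the sparsity condition), then for every
`z` with `|z| < p₀` the unique global minimizer of
`θ ↦ (1/2)(z − θ)² + p(|θ|)` is `θ = 0`. -/
theorem stmt_3 (p p' : ℝ → ℝ)
    (hcont : ContinuousOn p (Set.Ici 0))
    (hderiv : ∀ t : ℝ, 0 < t → HasDerivAt p (p' t) t)
    (p₀ : ℝ) (hp₀ : 0 < p₀)
    (hsparse : ∀ t : ℝ, 0 < t → p₀ ≤ t + p' t)
    (z : ℝ) (hz : |z| < p₀) :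
    ∀ θ : ℝ, θ ≠ 0 →
      (1 / 2) * (z - 0) ^ 2 + p |(0 : ℝ)| < (1 / 2) * (z - θ) ^ 2 + p |θ| := by
  intro θ hθ
  have hb : 0 < |θ| := abs_pos.mpr hθ
  obtain ⟨c, hc, hslope⟩ := exists_hasDerivAt_eq_slope
    (fun t => t ^ 2 / 2 + p t) (fun t => t + p' t) hb
    (((continuous_id.pow 2).div_const 2).continuousOn.add
      (hcont.mono Set.Icc_subset_Ici_self))
    (fun t ht => by
      have hsq : HasDerivAt (fun t : ℝ => t ^ 2 / 2) t t := by
        simpa using ((hasDerivAt_id t).pow 2).div_const 2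
      exact hsq.add (hderiv t ht.1))
  have hincr : p₀ * |θ| ≤ |θ| ^ 2 / 2 + p |θ| - p 0 := by
    have hle := hsparse c hc.1
    rw [hslope, sub_zero, le_div_iff₀ hb] at hle
    simpa using hle
  have hlt : |z| * |θ| < p₀ * |θ| := mul_lt_mul_of_pos_right hz hb
  have hzθ : z * θ ≤ |z| * |θ| := (le_abs_self _).trans_eq (abs_mul z θ)
  rw [sq_abs] at hincr
  rw [abs_zero]
  linarith [show (z - θ) ^ 2 = z ^ 2 - 2 * (z * θ) + θ ^ 2 by ring]
end

section
/- Let p : [0,∞) → ℝ be nondecreasing and suppose there exist T > 0 and C ∈ ℝ such that p(t) = C for all t ≥ T (i.e., the derivative of the penalty vanishes beyond T). Then for every z ∈ ℝ with |z| ≥ T + √(2(C − p(0))), the point θ = z is a global minimizer of the univariate penalized least squares objective f(θ) = (1/2)(z − θ)² + p(|θ|); moreover if |z| > T + √(2(C − p(0))) then θ = z is the unique global minimizer. (Unbiasedness property: the estimator equals z for large |z| when the penalty is eventually flat.) -/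
/-- Unbiasedness property: if the penalty `p` is nondecreasing on `[0,∞)` and
eventually flat (`p(t) = C` for `t ≥ T`), then for `|z| ≥ T + √(2(C − p(0)))`
the point `θ = z` is a global minimizer of `θ ↦ (1/2)(z − θ)² + p(|θ|)`, and
for `|z| > T + √(2(C − p(0)))` it is the unique global minimizer. -/
theorem stmt_4 (p : ℝ → ℝ) (hmono : MonotoneOn p (Set.Ici 0))
    (T : ℝ) (hT : 0 < T) (C : ℝ) (hflat : ∀ t : ℝ, T ≤ t → p t = C)
    (z : ℝ) (hz : T + Real.sqrt (2 * (C - p 0)) ≤ |z|) :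
    (∀ θ : ℝ,
      (1 / 2) * (z - z) ^ 2 + p |z| ≤ (1 / 2) * (z - θ) ^ 2 + p |θ|) ∧
    (T + Real.sqrt (2 * (C - p 0)) < |z| →
      ∀ θ : ℝ, θ ≠ z →
        (1 / 2) * (z - z) ^ 2 + p |z| < (1 / 2) * (z - θ) ^ 2 + p |θ|) := by
  have hs : 0 ≤ Real.sqrt (2 * (C - p 0)) := Real.sqrt_nonneg _
  have hpz : p |z| = C := hflat _ (by linarith)
  -- The strict inequality already holds under the non-strict bound on `|z|`.
  have hstrict : ∀ θ : ℝ, θ ≠ z →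
      (1 / 2) * (z - z) ^ 2 + p |z| < (1 / 2) * (z - θ) ^ 2 + p |θ| := by
    intro θ hθ
    rw [hpz, sub_self]
    rcases le_or_gt T |θ| with h | h
    · rw [hflat _ h]
      have : 0 < (z - θ) ^ 2 := sq_pos_of_ne_zero (sub_ne_zero.mpr hθ.symm)
      linarith
    · have hp0 : p 0 ≤ p |θ| :=
        hmono Set.self_mem_Ici (Set.mem_Ici.mpr (abs_nonneg θ)) (abs_nonneg θ)
      have hC : p 0 ≤ C := by
        rw [← hflat T le_rfl]
        exact hmono Set.self_mem_Ici (Set.mem_Ici.mpr hT.le) hT.le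
      have hlt : Real.sqrt (2 * (C - p 0)) < |z - θ| := by
        linarith [abs_sub_abs_le_abs_sub z θ]
      have hsq : 2 * (C - p 0) < |z - θ| ^ 2 :=
        (Real.sqrt_lt (by linarith) (abs_nonneg _)).mp hlt
      rw [sq_abs] at hsq
      linarith
  refine ⟨fun θ => ?_, fun _ => hstrict⟩
  rcases eq_or_ne θ z with rfl | hθ
  · exact le_rfl
  · exact (hstrict θ hθ).le
end

section
/- Let λ > 0 and let the hard thresholding penalty be p_λ(t) = λ² − ((λ − t)⁺)² for t ≥ 0, where x⁺ = max(x,0). Then for every z ∈ ℝ, the hard-thresholding estimate θ̂_H(z) = z·1{|z| > λ} is a global minimizer over θ ∈ ℝ of f(θ) = (z − θ)² + p_λ(|θ|); moreover, when |z| ≠ λ it is the unique global minimizer. -/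
/-- Inside the threshold, the hard-thresholding objective is piecewise linear. -/
theorem hardThreshold_objective_of_abs_le {lam z θ : ℝ} (h : |θ| ≤ lam) :
    (z - θ) ^ 2 + (lam ^ 2 - (max (lam - |θ|) 0) ^ 2) = z ^ 2 - 2 * (z * θ) + 2 * lam * |θ| := by
  rw [max_eq_left (by linarith)]
  linear_combination -sq_abs θ

/-- Beyond the threshold, the hard thresholding penalty is constant. -/
theorem hardThreshold_objective_of_le_abs {lam z θ : ℝ} (h : lam ≤ |θ|) :
    (z - θ) ^ 2 + (lam ^ 2 - (max (lam - |θ|) 0) ^ 2) = (z - θ) ^ 2 + lam ^ 2 := by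
  rw [max_eq_right (by linarith)]
  ring

/-- Hard thresholding: for the hard thresholding penalty
`p_λ(t) = λ² − ((λ − t)⁺)²` with `λ > 0`, the hard-thresholding estimate
`θ̂_H(z) = z·1{|z| > λ}` is a global minimizer of
`θ ↦ (z − θ)² + p_λ(|θ|)`, and is the unique global minimizer when
`|z| ≠ λ`. -/
theorem stmt_5 (lam : ℝ) (hlam : 0 < lam) (z : ℝ)
    (pen : ℝ → ℝ) (hpen : ∀ t : ℝ, pen t = lam ^ 2 - (max (lam - t) 0) ^ 2)
    (θhat : ℝ) (hθhat : θhat = if lam < |z| then z else 0) :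
    (∀ θ : ℝ, (z - θhat) ^ 2 + pen |θhat| ≤ (z - θ) ^ 2 + pen |θ|) ∧
    (|z| ≠ lam →
      ∀ θ : ℝ, θ ≠ θhat → (z - θhat) ^ 2 + pen |θhat| < (z - θ) ^ 2 + pen |θ|) := by
  have hz := sq_abs z
  have hmul (θ : ℝ) : z * θ ≤ |z| * |θ| := abs_mul z θ ▸ le_abs_self _
  simp only [hpen]
  split_ifs at hθhat with h <;> subst θhat
  · rw [hardThreshold_objective_of_le_abs h.le]
    have strict (θ : ℝ) (hθ : θ ≠ z) : (z - z) ^ 2 + lam ^ 2 <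
        (z - θ) ^ 2 + (lam ^ 2 - (max (lam - |θ|) 0) ^ 2) := by
      rcases le_total |θ| lam with hl | hl
      · rw [hardThreshold_objective_of_abs_le hl]
        have : 0 < (|z| - lam) * (|z| + lam - 2 * |θ|) :=
          mul_pos (by linarith) (by linarith)
        linarith [hmul θ]
      · rw [hardThreshold_objective_of_le_abs hl]
        have : 0 < (z - θ) ^ 2 := sq_pos_of_ne_zero (sub_ne_zero.2 hθ.symm)
        linarith
    refine ⟨fun θ => ?_, fun _ => strict⟩
    rcases eq_or_ne θ z with rfl | hθ
    · rw [hardThreshold_objective_of_le_abs h.le]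
    · exact (strict θ hθ).le
  · rw [not_lt] at h
    rw [hardThreshold_objective_of_abs_le (by simpa using hlam.le)]
    simp only [mul_zero, abs_zero, sub_zero, add_zero]
    have lower (θ : ℝ) : z ^ 2 + 2 * ((lam - |z|) * |θ|) ≤
        (z - θ) ^ 2 + (lam ^ 2 - (max (lam - |θ|) 0) ^ 2) := by
      rcases le_total |θ| lam with hl | hl
      · rw [hardThreshold_objective_of_abs_le hl]
        linarith [hmul θ]
      · rw [hardThreshold_objective_of_le_abs hl]
        linarith [hmul θ, sq_nonneg (|θ| - lam), sq_abs θ]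
    refine ⟨fun θ => ?_, fun hne θ hθ => ?_⟩
    · have : 0 ≤ (lam - |z|) * |θ| := mul_nonneg (by linarith) (abs_nonneg θ)
      linarith [lower θ]
    · have : 0 < (lam - |z|) * |θ| :=
        mul_pos (sub_pos.2 (lt_of_le_of_ne h hne)) (abs_pos.2 hθ)
      linarith [lower θ]
end

section
/- Let λ > 0 and a > 2, and let the SCAD penalty be p_λ(t) = ∫₀ᵗ λ[1{s ≤ λ} + ((aλ − s)⁺/((a − 1)λ))·1{s > λ}] ds for t ≥ 0. Then for every z ∈ ℝ, a global minimizer over θ ∈ ℝ of f(θ) = (1/2)(z − θ)² + p_λ(|θ|) is given by the SCAD thresholding rule: θ̂(z) = sgn(z)·(|z| − λ)⁺ when |z| ≤ 2λ; θ̂(z) = ((a − 1)z − sgn(z)·aλ)/(a − 2) when 2λ < |z| ≤ aλ; and θ̂(z) = z when |z| > aλ. -/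
/-- The SCAD penalty derivative
`p_λ′(t) = λ[1{t ≤ λ} + ((aλ − t)⁺/((a − 1)λ))·1{t > λ}]`. -/
noncomputable def scadDeriv (lam a t : ℝ) : ℝ :=
  lam * ((if t ≤ lam then 1 else 0) +
    (max (a * lam - t) 0 / ((a - 1) * lam)) * (if lam < t then 1 else 0))

/-- The SCAD penalty `p_λ(t) = ∫₀ᵗ p_λ′(s) ds`. -/
noncomputable def scadPen (lam a t : ℝ) : ℝ := ∫ s in (0 : ℝ)..t, scadDeriv lam a s

/-- The SCAD penalty derivative as a minimum of continuous functions. -/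
lemma scadDeriv_eq_min {lam a : ℝ} (hlam : 0 < lam) (ha : 1 < a) (t : ℝ) :
    scadDeriv lam a t = min lam (max (a * lam - t) 0 / (a - 1)) := by
  have ha' : 0 < a - 1 := by linarith
  unfold scadDeriv
  rcases le_or_gt t lam with h | h
  · rw [if_pos h, if_neg h.not_gt, min_eq_left]
    · ring
    · rw [le_div_iff₀ ha']
      exact le_max_of_le_left (by linarith)
  · rw [if_neg h.not_ge, if_pos h, min_eq_right]
    · field_simp
      ring
    · rw [div_le_iff₀ ha']
      exact max_le (by linarith) (by positivity)

lemma continuous_scadDeriv {lam a : ℝ} (hlam : 0 < lam) (ha : 1 < a) :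
    Continuous (scadDeriv lam a) := by
  rw [funext (scadDeriv_eq_min hlam ha)]
  fun_prop

lemma monotone_id_add_scadDeriv {lam a : ℝ} (hlam : 0 < lam) (ha : 2 ≤ a) :
    Monotone fun t => t + scadDeriv lam a t := by
  intro s t hst
  have ha' : 0 < a - 1 := by linarith
  simp only [scadDeriv_eq_min hlam (by linarith : 1 < a), ← min_add_add_left]
  refine min_le_min (by linarith) ?_
  have key : max (a * lam - s) 0 ≤ max (a * lam - t) 0 + (t - s) :=
    max_le (by linarith [le_max_left (a * lam - t) 0])
      (by linarith [le_max_right (a * lam - t) 0])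
  have hdiv : (t - s) / (a - 1) ≤ t - s := div_le_self (by linarith) (by linarith)
  have := div_le_div_of_nonneg_right key ha'.le
  rw [add_div] at this
  linarith

/-- First-order sufficient condition for a minimizer of the SCAD objective on `[0, ∞)`. -/
lemma scad_objective_le_of_stationary {lam a : ℝ} (hlam : 0 < lam) (ha : 2 ≤ a) {w u t : ℝ}
    (ht : 0 ≤ t) (hle : w ≤ u + scadDeriv lam a u)
    (heq : u + scadDeriv lam a u = w ∨ u = 0) :
    1 / 2 * (w - u) ^ 2 + scadPen lam a u ≤ 1 / 2 * (w - t) ^ 2 + scadPen lam a t := by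
  have hc := continuous_scadDeriv hlam (by linarith : 1 < a)
  have hmono := monotone_id_add_scadDeriv hlam ha
  have hsub : scadPen lam a t - scadPen lam a u = ∫ s in u..t, scadDeriv lam a s :=
    intervalIntegral.integral_interval_sub_left (hc.intervalIntegrable _ _)
      (hc.intervalIntegrable _ _)
  have hsum : ∫ s in u..t, (s + scadDeriv lam a s) =
      (t ^ 2 - u ^ 2) / 2 + ∫ s in u..t, scadDeriv lam a s := by
    rw [intervalIntegral.integral_add intervalIntegral.intervalIntegrable_id
      (hc.intervalIntegrable _ _), integral_id]
  have hbound : w * (t - u) ≤ ∫ s in u..t, (s + scadDeriv lam a s) := by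
    have hint (x y : ℝ) :
        IntervalIntegrable (fun s => s + scadDeriv lam a s) MeasureTheory.volume x y :=
      (continuous_id.add hc).intervalIntegrable x y
    rcases le_or_gt u t with hut | hut
    · have := intervalIntegral.integral_mono_on hut intervalIntegrable_const (hint u t)
        (f := fun _ => w) fun s hs => hle.trans (hmono hs.1)
      rw [intervalIntegral.integral_const, smul_eq_mul] at this
      linarith
    · have hstat : u + scadDeriv lam a u = w := heq.resolve_right (by linarith)
      have := intervalIntegral.integral_mono_on hut.le (hint t u) intervalIntegrable_const
        (g := fun _ => w) fun s hs => (hmono hs.2).trans hstat.le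
      rw [intervalIntegral.integral_const, smul_eq_mul] at this
      rw [intervalIntegral.integral_symm]
      linarith
  nlinarith

/-- The SCAD thresholding rule for a nonnegative observation. -/
noncomputable def scadThreshold (lam a w : ℝ) : ℝ :=
  if w ≤ 2 * lam then max (w - lam) 0
  else if w ≤ a * lam then ((a - 1) * w - a * lam) / (a - 2)
  else w

lemma scadThreshold_nonneg {lam a w : ℝ} (hlam : 0 < lam) (ha : 2 < a) :
    0 ≤ scadThreshold lam a w := by
  unfold scadThreshold
  split_ifs with h₁ h₂
  · exact le_max_right _ _
  · exact div_nonneg (by nlinarith) (by linarith)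
  · linarith

lemma scadThreshold_stationary {lam a w : ℝ} (hlam : 0 < lam) (ha : 2 < a) :
    w ≤ scadThreshold lam a w + scadDeriv lam a (scadThreshold lam a w) ∧
      (scadThreshold lam a w + scadDeriv lam a (scadThreshold lam a w) = w ∨
        scadThreshold lam a w = 0) := by
  have ha₁ : 0 < a - 1 := by linarith
  have ha₂ : 0 < a - 2 := by linarith
  have hsmall {t : ℝ} (ht : t ≤ lam) : scadDeriv lam a t = lam := by
    simp [scadDeriv, ht, ht.not_gt]
  by_cases h₁ : w ≤ 2 * lam
  · rw [scadThreshold, if_pos h₁, hsmall (max_le (by linarith) hlam.le)]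
    rcases le_total (w - lam) 0 with h | h
    · rw [max_eq_right h]
      exact ⟨by linarith, Or.inr rfl⟩
    · rw [max_eq_left h]
      exact ⟨by linarith, Or.inl (by ring)⟩
  · suffices h : scadThreshold lam a w + scadDeriv lam a (scadThreshold lam a w) = w from
      ⟨h.ge, Or.inl h⟩
    push Not at h₁
    rw [scadDeriv_eq_min hlam (by linarith : 1 < a), scadThreshold, if_neg h₁.not_ge]
    split_ifs with h₂
    · have hdiff : a * lam - ((a - 1) * w - a * lam) / (a - 2) =
          (a - 1) * ((a * lam - w) / (a - 2)) := by
        field_simp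
        ring
      have hnonneg : 0 ≤ (a * lam - w) / (a - 2) := div_nonneg (by linarith) ha₂.le
      rw [hdiff, max_eq_left (mul_nonneg ha₁.le hnonneg), mul_div_cancel_left₀ _ ha₁.ne',
        min_eq_right]
      · field_simp
        ring
      · rw [div_le_iff₀ ha₂]
        linarith
    · rw [max_eq_right (by linarith), zero_div, min_eq_right hlam.le, add_zero]

/-- The SCAD thresholding rule is a global minimizer of the SCAD penalized
least squares objective `θ ↦ (1/2)(z − θ)² + p_λ(|θ|)`: it equals
`sgn(z)(|z| − λ)⁺` when `|z| ≤ 2λ`, `((a − 1)z − sgn(z)aλ)/(a − 2)` when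
`2λ < |z| ≤ aλ`, and `z` when `|z| > aλ`. -/
theorem stmt_8 (lam a : ℝ) (hlam : 0 < lam) (ha : 2 < a) (z : ℝ)
    (θhat : ℝ)
    (hθhat : θhat =
      if |z| ≤ 2 * lam then Real.sign z * max (|z| - lam) 0
      else if |z| ≤ a * lam then ((a - 1) * z - Real.sign z * (a * lam)) / (a - 2)
      else z) :
    ∀ θ : ℝ,
      (1 / 2) * (z - θhat) ^ 2 + scadPen lam a |θhat|
        ≤ (1 / 2) * (z - θ) ^ 2 + scadPen lam a |θ| := by
  intro θ
  have hnonneg := scadThreshold_nonneg (w := |z|) hlam ha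
  have hθ : |θhat| = scadThreshold lam a |z| ∧
      (z - θhat) ^ 2 = (|z| - scadThreshold lam a |z|) ^ 2 := by
    rcases lt_trichotomy z 0 with hz | rfl | hz
    · have : θhat = -scadThreshold lam a |z| := by
        rw [hθhat, scadThreshold, Real.sign_of_neg hz, abs_of_neg hz]
        split_ifs <;> ring
      rw [this, abs_neg, abs_of_nonneg hnonneg, abs_of_neg hz]
      exact ⟨rfl, by ring⟩
    · have : scadThreshold lam a 0 = 0 := by
        simp [scadThreshold, hlam.le]
      simp [hθhat, this, hlam.le]
    · have : θhat = scadThreshold lam a |z| := by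
        rw [hθhat, scadThreshold, Real.sign_of_pos hz, abs_of_pos hz]
        simp only [one_mul]
      rw [this, abs_of_nonneg hnonneg, abs_of_pos hz]
      exact ⟨rfl, rfl⟩
  obtain ⟨hle, heq⟩ := scadThreshold_stationary (w := |z|) hlam ha
  have hmin := scad_objective_le_of_stationary hlam ha.le (abs_nonneg θ) hle heq
  have hsq : (|z| - |θ|) ^ 2 ≤ (z - θ) ^ 2 := sq_le_sq.2 (abs_abs_sub_abs_le z θ)
  rw [hθ.1, hθ.2]
  linarith
end

section
/- Let p : [0,∞) → ℝ be nondecreasing and concave on [0,∞), let t₀ > 0, and suppose p is differentiable at t₀ with derivative p′(t₀). Then the local quadratic approximation majorizes the penalty: for every θ ∈ ℝ, p(|θ|) ≤ p(t₀) + (p′(t₀)/(2t₀))·(θ² − t₀²), with equality when |θ| = t₀. -/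
/-- A concave function lies below its tangent line at a point of differentiability. -/
theorem ConcaveOn.le_tangent_of_hasDerivAt {S : Set ℝ} {f : ℝ → ℝ} {f' x y : ℝ}
    (hf : ConcaveOn ℝ S f) (hx : x ∈ S) (hy : y ∈ S) (hderiv : HasDerivAt f f' x) :
    f y ≤ f x + f' * (y - x) := by
  rcases lt_trichotomy x y with hxy | rfl | hxy
  · have h := hf.slope_le_of_hasDerivAt hx hy hxy hderiv
    rw [slope_def_field, div_le_iff₀ (sub_pos.2 hxy)] at h
    linarith
  · simp
  · have h := hf.le_slope_of_hasDerivAt hy hx hxy hderiv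
    rw [slope_def_field, le_div_iff₀ (sub_pos.2 hxy)] at h
    linarith

/-- The local quadratic approximation (LQA) majorizes a nondecreasing concave
penalty: if `p` is nondecreasing and concave on `[0,∞)`, `t₀ > 0`, and `p` is
differentiable at `t₀` with derivative `p'`, then for every `θ`,
`p(|θ|) ≤ p(t₀) + (p'/(2t₀))(θ² − t₀²)`, with equality when `|θ| = t₀`. -/
theorem stmt_11 (p : ℝ → ℝ) (hmono : MonotoneOn p (Set.Ici 0))
    (hconc : ConcaveOn ℝ (Set.Ici 0) p)
    (t₀ : ℝ) (ht₀ : 0 < t₀) (p' : ℝ) (hderiv : HasDerivAt p p' t₀) :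
    (∀ θ : ℝ, p |θ| ≤ p t₀ + (p' / (2 * t₀)) * (θ ^ 2 - t₀ ^ 2)) ∧
    (∀ θ : ℝ, |θ| = t₀ → p |θ| = p t₀ + (p' / (2 * t₀)) * (θ ^ 2 - t₀ ^ 2)) := by
  have hmem : t₀ ∈ Set.Ici (0 : ℝ) := ht₀.le
  have hp' : 0 ≤ p' := by
    have hmem' : t₀ + 1 ∈ Set.Ici (0 : ℝ) := by
      simp only [Set.mem_Ici]
      linarith
    have htangent := hconc.le_tangent_of_hasDerivAt hmem hmem' hderiv
    have hle := hmono hmem hmem' (by linarith)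
    linarith
  refine ⟨fun θ => ?_, fun θ hθ => ?_⟩
  · have htangent := hconc.le_tangent_of_hasDerivAt hmem (abs_nonneg θ) hderiv
    have hgap : 0 ≤ p' / (2 * t₀) * (|θ| - t₀) ^ 2 := by positivity
    have hsplit : p' / (2 * t₀) * (θ ^ 2 - t₀ ^ 2) =
        p' * (|θ| - t₀) + p' / (2 * t₀) * (|θ| - t₀) ^ 2 := by
      rw [← sq_abs θ]
      field_simp
      ring
    linarith
  · rw [← sq_abs θ, hθ]
    ring
end

section
/- Let p : [0,∞) → ℝ be concave on [0,∞), let t₀ > 0, and suppose p is differentiable at t₀ with derivative p′(t₀). Let g : [0,∞) → ℝ be any convex function on [0,∞) such that g(t) ≥ p(t) for all t ≥ 0 and g(t₀) = p(t₀). Then g(t) ≥ p(t₀) + p′(t₀)·(t − t₀) for all t ≥ 0. That is, the local linear approximation is the minimum (tightest) convex majorant of the concave penalty on [0,∞) touching it at t₀. -/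
/-- A convex function that majorizes `p` on `S` and touches it at `x` lies above the tangent line
to `p` at `x`. -/
theorem ConvexOn.tangent_le_of_touching_majorant {S : Set ℝ} {p g : ℝ → ℝ} {x y p' : ℝ}
    (hg : ConvexOn ℝ S g) (hx : x ∈ S) (hy : y ∈ S) (hp : HasDerivAt p p' x)
    (hpg : ∀ t ∈ S, p t ≤ g t) (htouch : g x = p x) :
    p x + p' * (y - x) ≤ g y := by
  have hline : HasDerivAt (fun s : ℝ => p (x + s * (y - x))) (p' * (y - x)) 0 := by
    have hinner : HasDerivAt (fun s : ℝ => x + s * (y - x)) (y - x) 0 := by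
      simpa using ((hasDerivAt_id (0 : ℝ)).mul_const (y - x)).const_add x
    exact HasDerivAt.comp (0 : ℝ) (by simpa using hp) hinner
  have hslope : p' * (y - x) ≤ g y - p x := by
    refine le_of_tendsto hline.tendsto_slope_zero_right ?_
    filter_upwards [Ioo_mem_nhdsGT (zero_lt_one (α := ℝ))] with s ⟨hs0, hs1⟩
    have hcomb : (1 - s) • x + s • y = x + s * (y - x) := by
      simp only [smul_eq_mul]; ring
    have hmem := hg.1 hx hy (sub_nonneg.2 hs1.le) hs0.le (sub_add_cancel 1 s)
    have hle := hg.2 hx hy (sub_nonneg.2 hs1.le) hs0.le (sub_add_cancel 1 s)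
    rw [hcomb] at hmem hle
    have hmaj := hpg _ hmem
    simp only [smul_eq_mul, zero_add, zero_mul, add_zero] at hle ⊢
    rw [inv_mul_le_iff₀ hs0]
    rw [htouch] at hle
    linarith
  linarith

/-- The local linear approximation is the minimum (tightest) convex majorant
of a concave penalty touching it at `t₀`: if `p` is concave on `[0,∞)`,
`t₀ > 0`, `p` is differentiable at `t₀` with derivative `p'`, and `g` is
convex on `[0,∞)` with `g ≥ p` on `[0,∞)` and `g(t₀) = p(t₀)`, then
`g(t) ≥ p(t₀) + p'·(t − t₀)` for all `t ≥ 0`. -/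
theorem stmt_13 (p : ℝ → ℝ) (hconc : ConcaveOn ℝ (Set.Ici 0) p)
    (t₀ : ℝ) (ht₀ : 0 < t₀) (p' : ℝ) (hderiv : HasDerivAt p p' t₀)
    (g : ℝ → ℝ) (hconv : ConvexOn ℝ (Set.Ici 0) g)
    (hmaj : ∀ t : ℝ, 0 ≤ t → p t ≤ g t) (htouch : g t₀ = p t₀) :
    ∀ t : ℝ, 0 ≤ t → p t₀ + p' * (t - t₀) ≤ g t := by
  intro t ht
  exact hconv.tangent_le_of_touching_majorant ht₀.le ht hderiv hmaj htouch
end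

section
/- Let r, d, n, m be natural numbers with 1 ≤ r ≤ d ≤ n and n² ≤ m. Then (C(d,r))² / C(m,r) ≤ (1/r!)·(n²/m)ʳ, where C(a,b) denotes the binomial coefficient 'a choose b'. Equivalently, (C(d,r))² · r! · mʳ ≤ n²ʳ · C(m,r). -/
theorem sub_sq_mul_le_sq_mul_sub {d n m : ℕ} (hdn : d ≤ n) (hnm : n ^ 2 ≤ m) (k : ℕ) :
    (d - k) ^ 2 * m ≤ n ^ 2 * (m - k) := by
  rcases le_or_gt d k with hdk | hkd
  · simp [Nat.sub_eq_zero_of_le hdk]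
  · have hkn : k ≤ n := by omega
    have hkm : k ≤ m := by nlinarith
    refine (Nat.mul_le_mul_right m (Nat.pow_le_pow_left (Nat.sub_le_sub_right hdn k) 2)).trans ?_
    have hn : 1 ≤ n := by omega
    zify [hkn, hkm] at *
    have h : (n : ℤ) ^ 2 + k * m ≤ 2 * n * m := by nlinarith
    nlinarith [mul_le_mul_of_nonneg_left h (Int.natCast_nonneg k)]

theorem descFactorial_sq_mul_pow_le {d n m : ℕ} (hdn : d ≤ n) (hnm : n ^ 2 ≤ m) (r : ℕ) :
    d.descFactorial r ^ 2 * m ^ r ≤ n ^ (2 * r) * m.descFactorial r := by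
  induction r with
  | zero => simp
  | succ k ih =>
    rw [Nat.descFactorial_succ, Nat.descFactorial_succ]
    calc ((d - k) * d.descFactorial k) ^ 2 * m ^ (k + 1)
        = ((d - k) ^ 2 * m) * (d.descFactorial k ^ 2 * m ^ k) := by ring
      _ ≤ (n ^ 2 * (m - k)) * (n ^ (2 * k) * m.descFactorial k) :=
          Nat.mul_le_mul (sub_sq_mul_le_sq_mul_sub hdn hnm k) ih
      _ = n ^ (2 * (k + 1)) * ((m - k) * m.descFactorial k) := by ring

theorem choose_sq_mul_factorial_mul_pow_le {d n m : ℕ} (hdn : d ≤ n) (hnm : n ^ 2 ≤ m) (r : ℕ) :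
    d.choose r ^ 2 * r.factorial * m ^ r ≤ n ^ (2 * r) * m.choose r := by
  have h := descFactorial_sq_mul_pow_le hdn hnm r
  rw [Nat.descFactorial_eq_factorial_mul_choose, Nat.descFactorial_eq_factorial_mul_choose] at h
  refine Nat.le_of_mul_le_mul_left ?_ r.factorial_pos
  linarith

/-- Combinatorial inequality behind the false positive bound for intersecting
two independently screened variable sets: for `1 ≤ r ≤ d ≤ n` and `n² ≤ m`,
`C(d,r)²/C(m,r) ≤ (1/r!)·(n²/m)ʳ`; equivalently,
`C(d,r)²·r!·mʳ ≤ n²ʳ·C(m,r)`. -/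
theorem stmt_15 (r d n m : ℕ) (hr : 1 ≤ r) (hrd : r ≤ d) (hdn : d ≤ n)
    (hnm : n ^ 2 ≤ m) :
    ((d.choose r : ℝ)) ^ 2 / (m.choose r : ℝ)
        ≤ (1 / (r.factorial : ℝ)) * (((n : ℝ) ^ 2) / (m : ℝ)) ^ r ∧
      (d.choose r) ^ 2 * r.factorial * m ^ r ≤ n ^ (2 * r) * m.choose r := by
  have h := choose_sq_mul_factorial_mul_pow_le hdn hnm r
  refine ⟨?_, h⟩
  have hrm : r ≤ m := by nlinarith
  have hm : (0 : ℝ) < m := by exact_mod_cast (by omega : 0 < m)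
  have hc : (0 : ℝ) < m.choose r := by exact_mod_cast Nat.choose_pos hrm
  have hf : (0 : ℝ) < r.factorial := by exact_mod_cast r.factorial_pos
  have h' : (d.choose r : ℝ) ^ 2 * r.factorial * m ^ r ≤ n ^ (2 * r) * m.choose r := by
    exact_mod_cast h
  rw [div_pow, ← pow_mul, div_mul_div_comm, one_mul, div_le_div_iff₀ hc (by positivity),
    ← mul_assoc]
  exact h'
end

section
/- Let n ≥ 1 and s ≥ 1, let X₁ be a real n×s matrix whose columns x₁,…,x_s are orthonormal, let β₁ ∈ ℝˢ satisfy |β_{1,j}| = b for all j with b > 0, and set y = X₁β₁ = Σⱼ β_{1,j} xⱼ. Let x ∈ ℝⁿ have unit Euclidean norm and correlation r with y, i.e., ⟨x, y⟩ = r‖y‖. Then xᵀ X₁ (X₁ᵀX₁)⁻¹ sgn(β₁) = r·√s, where sgn(β₁) ∈ ℝˢ is the componentwise sign vector of β₁. Consequently, the weak irrepresentable condition |xᵀ X₁ (X₁ᵀX₁)⁻¹ sgn(β₁)| ≤ 1 for this noise variable holds if and only if |r| ≤ s^{−1/2}, so the L₁ penalty can fail to recover the sparsest solution when the correlation of a noise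 variable with the response exceeds s^{−1/2}. -/
open Matrix

/-- A matrix with orthonormal columns preserves the sum of squares of a vector. -/
theorem sum_sq_mulVec_of_transpose_mul_self_eq_one {m k : Type*} [Fintype m] [Fintype k]
    [DecidableEq k] {A : Matrix m k ℝ} (hA : Aᵀ * A = 1) (v : k → ℝ) :
    ∑ i, (A *ᵥ v) i ^ 2 = ∑ j, v j ^ 2 := by
  have h : (A *ᵥ v) ⬝ᵥ (A *ᵥ v) = v ⬝ᵥ v := by
    rw [dotProduct_mulVec, ← mulVec_transpose, mulVec_mulVec, hA, one_mulVec]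
  simpa only [dotProduct, ← pow_two] using h

/-- A real number is its absolute value times its sign. -/
theorem abs_mul_real_sign (a : ℝ) : |a| * Real.sign a = a := by
  rcases lt_trichotomy a 0 with h | rfl | h
  · rw [Real.sign_of_neg h, abs_of_neg h]; ring
  · simp
  · rw [Real.sign_of_pos h, abs_of_pos h, mul_one]

/-- The illustrative example showing the limitation of the weak
irrepresentable condition: if the columns of `X₁` are orthonormal,
`|β_{1,j}| = b > 0` for all `j`, `y = X₁β₁`, and `x` has unit norm and
correlation `r` with `y` (i.e. `⟨x,y⟩ = r‖y‖`), then
`xᵀX₁(X₁ᵀX₁)⁻¹ sgn(β₁) = r√s`; consequently the weak irrepresentable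
condition `|xᵀX₁(X₁ᵀX₁)⁻¹ sgn(β₁)| ≤ 1` holds iff `|r| ≤ s^{−1/2}`. -/
theorem stmt_16 {n s : ℕ} (hn : 1 ≤ n) (hs : 1 ≤ s)
    (X₁ : Matrix (Fin n) (Fin s) ℝ)
    (hortho : X₁ᵀ * X₁ = (1 : Matrix (Fin s) (Fin s) ℝ))
    (b : ℝ) (hb : 0 < b) (β₁ : Fin s → ℝ) (hβ : ∀ j, |β₁ j| = b)
    (y : Fin n → ℝ) (hy : y = X₁.mulVec β₁)
    (x : Fin n → ℝ) (hx : ∑ i, x i ^ 2 = 1)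
    (r : ℝ) (hr : ∑ i, x i * y i = r * Real.sqrt (∑ i, y i ^ 2)) :
    (∑ i, x i * X₁.mulVec ((X₁ᵀ * X₁)⁻¹.mulVec fun j => Real.sign (β₁ j)) i
        = r * Real.sqrt s) ∧
      (|∑ i, x i * X₁.mulVec ((X₁ᵀ * X₁)⁻¹.mulVec fun j => Real.sign (β₁ j)) i| ≤ 1
        ↔ |r| ≤ 1 / Real.sqrt s) := by
  have hsqrt : 0 < Real.sqrt s := Real.sqrt_pos.2 (by exact_mod_cast hs)
  have hnorm : Real.sqrt (∑ i, y i ^ 2) = b * Real.sqrt s := by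
    have hsq : ∀ j, β₁ j ^ 2 = b ^ 2 := fun j => by rw [← hβ j, sq_abs]
    rw [hy, sum_sq_mulVec_of_transpose_mul_self_eq_one hortho]
    simp only [hsq, Finset.sum_const, Finset.card_univ, Fintype.card_fin, nsmul_eq_mul]
    rw [mul_comm, Real.sqrt_mul (sq_nonneg b), Real.sqrt_sq hb.le]
  have hsign : β₁ = b • fun j => Real.sign (β₁ j) := by
    ext j
    rw [Pi.smul_apply, smul_eq_mul, ← hβ j, abs_mul_real_sign]
  have hy' : y = b • X₁ *ᵥ fun j => Real.sign (β₁ j) := by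
    rw [hy, ← mulVec_smul, ← hsign]
  have key : ∑ i, x i * X₁.mulVec ((X₁ᵀ * X₁)⁻¹.mulVec fun j => Real.sign (β₁ j)) i
      = r * Real.sqrt s := by
    rw [hortho, inv_one, one_mulVec]
    apply mul_left_cancel₀ hb.ne'
    rw [hnorm, hy'] at hr
    simp only [Pi.smul_apply, smul_eq_mul, mul_left_comm _ b, ← Finset.mul_sum] at hr
    exact hr
  refine ⟨key, ?_⟩
  rw [key, abs_mul, abs_of_pos hsqrt, le_div_iff₀ hsqrt]
end
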